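/- Let X be a nonempty subset of ℝⁿ and let η : ℝⁿ × ℝⁿ → ℝⁿ and w : ℝⁿ → ℝⁿ. A function h : X → ℝ is w-preinvex with respect to η and w if and only if its epigraph epi(h) = {(z, α) ∈ X × ℝ : h(z) ≤ α} is a w-invex subset of ℝⁿ × ℝ with respect to the maps η̃((z₁,α),(z₂,β)) = (η(z₁,z₂), α − β) and w̃((z,β)) = (w(z), β) (i.e., for all (z₁,α), (z₂,β) ∈ epi(h) and δ ∈ [0,1], the point (w(z₂) + δ·η(z₁, w(z₂)), δα + (1−δ)β) belongs to epi(h)). -/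

import Mathlib

/-- h is w-preinvex w.r.t. η and w iff its epigraph
{(z, α) ∈ X × ℝ : h z ≤ α} is w-invex w.r.t. the induced maps. -/
theorem w_preinvex_iff_epigraph_w_invex {n : ℕ}
    (X : Set (Fin n → ℝ)) (hX : X.Nonempty)
    (η : (Fin n → ℝ) → (Fin n → ℝ) → (Fin n → ℝ)) (w : (Fin n → ℝ) → (Fin n → ℝ))
    (hXinvex : ∀ z₁ ∈ X, ∀ z₂ ∈ X, ∀ δ ∈ Set.Icc (0:ℝ) 1,
      w z₂ + δ • η z₁ (w z₂) ∈ X)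
    (h : (Fin n → ℝ) → ℝ) :
    (∀ z₁ ∈ X, ∀ z₂ ∈ X, ∀ δ ∈ Set.Icc (0:ℝ) 1,
        h (w z₂ + δ • η z₁ (w z₂)) ≤ δ * h z₁ + (1 - δ) * h z₂) ↔
    (∀ p ∈ {q : (Fin n → ℝ) × ℝ | q.1 ∈ X ∧ h q.1 ≤ q.2},
     ∀ p' ∈ {q : (Fin n → ℝ) × ℝ | q.1 ∈ X ∧ h q.1 ≤ q.2},
     ∀ δ ∈ Set.Icc (0:ℝ) 1,
        (w p'.1 + δ • η p.1 (w p'.1), δ * p.2 + (1 - δ) * p'.2) ∈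
          {q : (Fin n → ℝ) × ℝ | q.1 ∈ X ∧ h q.1 ≤ q.2}) := by
  constructor
  · rintro H ⟨z₁, a⟩ ⟨h1, ha⟩ ⟨z₂, b⟩ ⟨h2, hb⟩ δ hδ
    refine ⟨hXinvex z₁ h1 z₂ h2 δ hδ, (H z₁ h1 z₂ h2 δ hδ).trans ?_⟩
    exact add_le_add (mul_le_mul_of_nonneg_left ha hδ.1)
      (mul_le_mul_of_nonneg_left hb (sub_nonneg.2 hδ.2))
  · intro H z₁ h1 z₂ h2 δ hδ
    exact (H (z₁, h z₁) ⟨h1, le_refl _⟩ (z₂, h z₂) ⟨h2, le_refl _⟩ δ hδ).2
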